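/- arXiv:2312.10174 — 3 statements merged into one kernel-verified Lean document; each statement's English description precedes it below -/
import Mathlib

section
/- Let a, b ∈ ℂ with Re a > 0 and Re b > 0, and write s = Re a, t = Re b. Let W = {−w_m}_{m∈ℤ} with w_m = e^{(a+b)m}. Then there exist constants c₁, c₂ > 0 such that for every w ∈ ℂ∖{0}: c₁ ≤ |G(w)| / [exp((log|w|)²/(2(s+t)) − (log|w|)/2) · dist(w, W)] ≤ c₂, where dist(w, W) = inf_{m∈ℤ} |w + w_m|. -/
open MeasureTheory Filter Metric Complex

noncomputable section

/-- A set `Λ ⊆ ℝ` is separated. -/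
def Separated (Λ : Set ℝ) : Prop :=
  ∃ δ : ℝ, 0 < δ ∧ ∀ x ∈ Λ, ∀ y ∈ Λ, x ≠ y → δ ≤ |x - y|

/-- Lower Beurling density. -/
def lowerDensity (Λ : Set ℝ) : ℝ :=
  liminf (fun r : ℝ => ⨅ x : ℝ, ((Λ ∩ Set.Icc x (x + r)).ncard : ℝ) / r) atTop

def upperDensity (Λ : Set ℝ) : ℝ :=
  limsup (fun r : ℝ => ⨆ x : ℝ, ((Λ ∩ Set.Icc x (x + r)).ncard : ℝ) / r) atTop

/-- Gabor coefficient. -/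
def gaborCoef (g f : ℝ → ℂ) (p : ℝ × ℝ) : ℂ :=
  ∫ t : ℝ, f t * (starRingEnd ℂ) (Complex.exp (-2 * Real.pi * Complex.I * p.2 * t) * g (p.1 - t))

def IsGaborFrame (g : ℝ → ℂ) (S : Set (ℝ × ℝ)) : Prop :=
  ∃ A B : ℝ, 0 < A ∧ 0 < B ∧ ∀ f : ℝ → ℂ, MemLp f 2 (volume : Measure ℝ) →
    A * (∫ t : ℝ, ‖f t‖ ^ 2) ≤ (∑' p : S, ‖gaborCoef g f p‖ ^ 2) ∧
    (∑' p : S, ‖gaborCoef g f p‖ ^ 2) ≤ B * (∫ t : ℝ, ‖f t‖ ^ 2)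

/-- membership in shift invariant space -/
def InV2 (g : ℝ → ℂ) (f : ℝ → ℂ) : Prop :=
  ∃ c : ℤ → ℂ, Memℓp c 2 ∧ ∀ x : ℝ, HasSum (fun n : ℤ => c n * g (x - n)) (f x)

def IsSamplingSet (g : ℝ → ℂ) (Λ : Set ℝ) : Prop :=
  ∃ A B : ℝ, 0 < A ∧ 0 < B ∧ ∀ f : ℝ → ℂ, InV2 g f →
    A * (∫ t : ℝ, ‖f t‖ ^ 2) ≤ (∑' l : Λ, ‖f l‖ ^ 2) ∧
    (∑' l : Λ, ‖f l‖ ^ 2) ≤ B * (∫ t : ℝ, ‖f t‖ ^ 2)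

def IsInterpolatingSet (g : ℝ → ℂ) (Λ : Set ℝ) : Prop :=
  ∀ a : Λ → ℂ, Memℓp a 2 → ∃ f : ℝ → ℂ, InV2 g f ∧ ∀ l : Λ, f l = a l

def IsSamplingSeqV (g : ℝ → ℂ) (lam : ℤ → ℝ) : Prop :=
  ∃ A B : ℝ, 0 < A ∧ 0 < B ∧ ∀ f : ℝ → ℂ, InV2 g f →
    A * (∫ t : ℝ, ‖f t‖ ^ 2) ≤ (∑' m : ℤ, ‖f (lam m)‖ ^ 2) ∧
    (∑' m : ℤ, ‖f (lam m)‖ ^ 2) ≤ B * (∫ t : ℝ, ‖f t‖ ^ 2)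

/-- Fock weight function φ. -/
def phiF (β γ : ℝ) (z : ℂ) : ℝ :=
  β * (Real.log ‖z‖) ^ 2 + γ * Real.log ‖z‖

def MemFock (β γ : ℝ) (F : ℂ → ℂ) : Prop :=
  DifferentiableOn ℂ F {(0 : ℂ)}ᶜ ∧
    Integrable (fun z : ℂ => ‖F z‖ ^ 2 * Real.exp (-2 * phiF β γ z)) volume

def fockNormSq (β γ : ℝ) (F : ℂ → ℂ) : ℝ :=
  (1 / Real.pi) * ∫ z : ℂ, ‖F z‖ ^ 2 * Real.exp (-2 * phiF β γ z)

def fockWeight (β γ : ℝ) (w : ℂ) : ℝ :=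
  (1 + ‖w‖ ^ 2) * Real.exp (-2 * phiF β γ w)

def IsFockSamplingSeq (β γ : ℝ) (u : ℤ → ℂ) : Prop :=
  ∃ A B : ℝ, 0 < A ∧ 0 < B ∧ ∀ F : ℂ → ℂ, MemFock β γ F →
    A * fockNormSq β γ F ≤ (∑' m : ℤ, fockWeight β γ (u m) * ‖F (u m)‖ ^ 2) ∧
    (∑' m : ℤ, fockWeight β γ (u m) * ‖F (u m)‖ ^ 2) ≤ B * fockNormSq β γ F

def IsFockInterpolatingSeq (β γ : ℝ) (u : ℤ → ℂ) : Prop :=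
  ∀ a : ℤ → ℂ, Summable (fun m : ℤ => fockWeight β γ (u m) * ‖a m‖ ^ 2) →
    ∃ F : ℂ → ℂ, MemFock β γ F ∧ ∀ m : ℤ, F (u m) = a m

def IsFockSamplingSet (β γ : ℝ) (Λ : Set ℂ) : Prop :=
  ∃ A B : ℝ, 0 < A ∧ 0 < B ∧ ∀ F : ℂ → ℂ, MemFock β γ F →
    A * fockNormSq β γ F ≤ (∑' w : Λ, fockWeight β γ w * ‖F w‖ ^ 2) ∧
    (∑' w : Λ, fockWeight β γ w * ‖F w‖ ^ 2) ≤ B * fockNormSq β γ F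

def IsFockInterpolatingSet (β γ : ℝ) (Λ : Set ℂ) : Prop :=
  ∀ a : Λ → ℂ, Summable (fun w : Λ => fockWeight β γ (w : ℂ) * ‖a w‖ ^ 2) →
    ∃ F : ℂ → ℂ, MemFock β γ F ∧ ∀ w : Λ, F w = a w

/-- the canonical product A(z) -/
def Afun (a b : ℂ) (z : ℂ) : ℂ :=
  ∏' n : ℕ, (1 + z * Complex.exp (-(a + b) * (n + 1)))

def Gfun (a b : ℂ) (z : ℂ) : ℂ := (1 + z) * Afun a b z * Afun a b (1 / z)

/-- the discrete Cauchy transform G(z) Σ c_n e^{an}/(z+e^{(a+b)n}) -/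
def cauchyT (a b : ℂ) (c : ℤ → ℂ) (z : ℂ) : ℂ :=
  Gfun a b z * ∑' n : ℤ, c n * Complex.exp (a * n) / (z + Complex.exp ((a + b) * n))

/-- norm of the evaluation functional at `w` on `H_{a,b}` -/
def Hnorm (a b : ℂ) (w : ℂ) : ℝ :=
  sSup {r : ℝ | ∃ c : ℤ → ℂ, Memℓp c 2 ∧ (∑' n : ℤ, ‖c n‖ ^ 2) ≤ 1 ∧ r = ‖cauchyT a b c w‖}

def IsSamplingSeqH (a b : ℂ) (u : ℤ → ℂ) : Prop :=
  ∃ A B : ℝ, 0 < A ∧ 0 < B ∧ ∀ c : ℤ → ℂ, Memℓp c 2 →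
    A * (∑' n : ℤ, ‖c n‖ ^ 2) ≤ (∑' m : ℤ, ((Hnorm a b (u m)) ^ 2)⁻¹ * ‖cauchyT a b c (u m)‖ ^ 2) ∧
    (∑' m : ℤ, ((Hnorm a b (u m)) ^ 2)⁻¹ * ‖cauchyT a b c (u m)‖ ^ 2) ≤ B * (∑' n : ℤ, ‖c n‖ ^ 2)

/-- If `‖f i‖ ≤ g i < 1` with `g` summable, then `‖∏' (1 + f i)‖` lies between
`∏' (1 - g i)` and `∏' (1 + g i)`. -/
theorem norm_tprod_one_add_bounds {ι : Type*} {f : ι → ℂ} {g : ι → ℝ} (hg : Summable g)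
    (hg1 : ∀ i, g i < 1) (hfg : ∀ i, ‖f i‖ ≤ g i) :
    (∏' i, (1 - g i)) ≤ ‖∏' i, (1 + f i)‖ ∧ ‖∏' i, (1 + f i)‖ ≤ ∏' i, (1 + g i) := by
  have hf : Summable fun i => ‖f i‖ := hg.of_nonneg_of_le (fun i => norm_nonneg _) hfg
  have hF := (multipliable_one_add_of_summable hf).hasProd.norm
  have hU := (Real.multipliable_one_add_of_summable hg).hasProd
  have hL : HasProd (fun i => 1 - g i) (∏' i, (1 - g i)) := by
    have h := (Real.multipliable_one_add_of_summable hg.neg).hasProd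
    simpa only [← sub_eq_add_neg] using h
  constructor
  · refine le_of_tendsto_of_tendsto' hL hF fun s => Finset.prod_le_prod ?_ ?_
    · intro i _
      linarith [hg1 i]
    · intro i _
      have h := norm_sub_norm_le (1 : ℂ) (-f i)
      rw [norm_one, norm_neg, sub_neg_eq_add] at h
      linarith [hfg i]
  · refine le_of_tendsto_of_tendsto' hF hU fun s => Finset.prod_le_prod ?_ ?_
    · intro i _
      exact norm_nonneg _
    · intro i _
      have h := norm_add_le (1 : ℂ) (f i)
      rw [norm_one] at h
      linarith [hfg i]

theorem tprod_one_sub_pos {ι : Type*} {g : ι → ℝ} (hg : Summable g)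
    (hg1 : ∀ i, g i < 1) : 0 < ∏' i, (1 - g i) := by
  have h := tprod_one_add_ne_zero_of_summable (f := fun i => -g i)
    (fun i => by linarith [hg1 i]) (by simpa using hg.norm)
  simp only [← sub_eq_add_neg] at h
  refine lt_of_le_of_ne ?_ h.symm
  have hL : HasProd (fun i => 1 - g i) (∏' i, (1 - g i)) := by
    have h := (Real.multipliable_one_add_of_summable hg.neg).hasProd
    simpa only [← sub_eq_add_neg] using h
  refine ge_of_tendsto' hL fun s => Finset.prod_nonneg fun i _ => ?_
  linarith [hg1 i]

theorem norm_exp_neg_mul_nat_succ (c : ℂ) (n : ℕ) :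
    ‖Complex.exp (-c * (n + 1))‖ = Real.exp (-c.re * (n + 1)) := by
  rw [Complex.norm_exp]
  congr 1
  simp [Complex.mul_re]

theorem summable_exp_neg_mul_nat_succ {σ : ℝ} (hσ : 0 < σ) :
    Summable fun n : ℕ => Real.exp (-σ * (n + 1)) := by
  have h := (summable_geometric_of_lt_one (Real.exp_pos (-σ)).le
    (by simpa using hσ)).mul_left (Real.exp (-σ))
  refine h.congr fun n => ?_
  rw [← Real.exp_nat_mul, ← Real.exp_add]
  congr 1
  ring

theorem multipliable_Afun {a b : ℂ} (h : 0 < (a + b).re) (z : ℂ) :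
    Multipliable fun n : ℕ => 1 + z * Complex.exp (-(a + b) * (n + 1)) := by
  apply multipliable_one_add_of_summable
  simp only [norm_mul, norm_exp_neg_mul_nat_succ]
  exact (summable_exp_neg_mul_nat_succ h).mul_left _

theorem Afun_exp_mul {a b : ℂ} (h : 0 < (a + b).re) (z : ℂ) :
    Afun a b (Complex.exp (a + b) * z) = (1 + z) * Afun a b z := by
  have key (n : ℕ) :
      1 + Complex.exp (a + b) * z * Complex.exp (-(a + b) * ((n + 1 : ℕ) + 1)) =
        1 + z * Complex.exp (-(a + b) * (n + 1)) := by
    rw [mul_comm (Complex.exp _) z, mul_assoc, ← Complex.exp_add]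
    congr 3
    push_cast
    ring
  unfold Afun
  rw [tprod_eq_zero_mul']
  · simp only [key]
    congr 2
    rw [mul_comm (Complex.exp _) z, mul_assoc, ← Complex.exp_add]
    simp
  · simp only [key]
    exact multipliable_Afun h z

theorem Gfun_exp_mul {a b : ℂ} (h : 0 < (a + b).re) {z : ℂ} (hz : z ≠ 0) :
    Gfun a b (Complex.exp (a + b) * z) = Complex.exp (a + b) * z * Gfun a b z := by
  have hq : Complex.exp (a + b) ≠ 0 := Complex.exp_ne_zero _
  have hinv := Afun_exp_mul h (1 / (Complex.exp (a + b) * z))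
  rw [show Complex.exp (a + b) * (1 / (Complex.exp (a + b) * z)) = 1 / z by field_simp] at hinv
  unfold Gfun
  rw [Afun_exp_mul h, hinv]
  field_simp
  ring

/-- On a disc that contains no zero of `A`, the function `|A|` is bounded above and below. -/
theorem exists_norm_Afun_bounds {a b : ℂ} (h : 0 < (a + b).re) :
    ∃ α β : ℝ, 0 < α ∧ 0 < β ∧ ∀ z : ℂ, ‖z‖ ≤ Real.exp ((a + b).re / 2) →
      α ≤ ‖Afun a b z‖ ∧ ‖Afun a b z‖ ≤ β := by
  set σ := (a + b).re with hσ
  let g : ℕ → ℝ := fun n => Real.exp (σ / 2) * Real.exp (-σ * (n + 1))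
  have hg : Summable g := (summable_exp_neg_mul_nat_succ h).mul_left _
  have hg1 (n : ℕ) : g n < 1 := by
    have hn : (0 : ℝ) ≤ n := n.cast_nonneg
    simp only [g]
    rw [← Real.exp_add, Real.exp_lt_one_iff]
    nlinarith
  have hb (z : ℂ) (hz : ‖z‖ ≤ Real.exp (σ / 2)) :=
    norm_tprod_one_add_bounds (f := fun n : ℕ => z * Complex.exp (-(a + b) * (n + 1))) hg hg1
      (fun n => by
        rw [norm_mul, norm_exp_neg_mul_nat_succ]
        exact mul_le_mul_of_nonneg_right hz (Real.exp_pos _).le)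
  have hpos := tprod_one_sub_pos hg hg1
  refine ⟨_, _, hpos, ?_, hb⟩
  have h0 := hb 0 (by simpa using (Real.exp_pos (σ / 2)).le)
  linarith [h0.1, h0.2]

/-- The comparison function `exp(log²|w|/(2 Re(a+b)) − log|w|/2) · dist(w, W)`. -/
def gWeight (a b w : ℂ) : ℝ :=
  Real.exp ((Real.log ‖w‖) ^ 2 / (2 * (a.re + b.re)) - Real.log ‖w‖ / 2) *
    (⨅ m : ℤ, ‖w + Complex.exp ((a + b) * m)‖)

theorem iInf_norm_exp_mul_add (c w : ℂ) :
    (⨅ m : ℤ, ‖Complex.exp c * w + Complex.exp (c * m)‖) =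
      ‖Complex.exp c‖ * ⨅ m : ℤ, ‖w + Complex.exp (c * m)‖ := by
  rw [Real.mul_iInf_of_nonneg (norm_nonneg _), ← (Equiv.addRight (1 : ℤ)).iInf_comp]
  refine iInf_congr fun m => ?_
  rw [← norm_mul, mul_add, ← Complex.exp_add, Equiv.coe_addRight]
  congr 3
  push_cast
  ring

theorem gWeight_exp_mul {a b : ℂ} (h : 0 < (a + b).re) {w : ℂ} (hw : w ≠ 0) :
    gWeight a b (Complex.exp (a + b) * w) =
      ‖Complex.exp (a + b) * w‖ * gWeight a b w := by
  have hs : 0 < a.re + b.re := by simpa using h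
  have hlog : Real.log ‖Complex.exp (a + b) * w‖ = a.re + b.re + Real.log ‖w‖ := by
    rw [norm_mul, Real.log_mul (by simp) (by simpa using hw), Complex.norm_exp, Real.log_exp,
      Complex.add_re]
  have hexp : Real.exp ((a.re + b.re + Real.log ‖w‖) ^ 2 / (2 * (a.re + b.re)) -
      (a.re + b.re + Real.log ‖w‖) / 2) =
      ‖w‖ * Real.exp ((Real.log ‖w‖) ^ 2 / (2 * (a.re + b.re)) - Real.log ‖w‖ / 2) := by
    conv_rhs => rw [← Real.exp_log (norm_pos_iff.2 hw), ← Real.exp_add]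
    rw [Real.log_exp]
    congr 1
    field_simp
    ring
  unfold gWeight
  rw [hlog, hexp, iInf_norm_exp_mul_add, norm_mul]
  ring

/-- Two-sided comparison of `|G|` with `gWeight` at a point is invariant under `w ↦ e^{a+b} w`. -/
theorem Gfun_bounds_exp_mul {a b : ℂ} (h : 0 < (a + b).re) (c₁ c₂ : ℝ) {w : ℂ} (hw : w ≠ 0) :
    (c₁ * gWeight a b (Complex.exp (a + b) * w) ≤ ‖Gfun a b (Complex.exp (a + b) * w)‖ ∧
      ‖Gfun a b (Complex.exp (a + b) * w)‖ ≤ c₂ * gWeight a b (Complex.exp (a + b) * w)) ↔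
    (c₁ * gWeight a b w ≤ ‖Gfun a b w‖ ∧ ‖Gfun a b w‖ ≤ c₂ * gWeight a b w) := by
  have hpos : 0 < ‖Complex.exp (a + b) * w‖ :=
    norm_pos_iff.2 (mul_ne_zero (Complex.exp_ne_zero _) hw)
  rw [Gfun_exp_mul h hw, gWeight_exp_mul h hw, norm_mul _ (Gfun a b w), mul_left_comm c₁,
    mul_left_comm c₂, mul_le_mul_iff_right₀ hpos, mul_le_mul_iff_right₀ hpos]

theorem Gfun_bounds_exp_int_mul {a b : ℂ} (h : 0 < (a + b).re) (c₁ c₂ : ℝ) {w : ℂ} (hw : w ≠ 0)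
    (k : ℤ) :
    (c₁ * gWeight a b (Complex.exp ((a + b) * k) * w) ≤
        ‖Gfun a b (Complex.exp ((a + b) * k) * w)‖ ∧
      ‖Gfun a b (Complex.exp ((a + b) * k) * w)‖ ≤
        c₂ * gWeight a b (Complex.exp ((a + b) * k) * w)) ↔
    (c₁ * gWeight a b w ≤ ‖Gfun a b w‖ ∧ ‖Gfun a b w‖ ≤ c₂ * gWeight a b w) := by
  have step (j : ℤ) : Complex.exp ((a + b) * (j + 1 : ℤ)) * w =
      Complex.exp (a + b) * (Complex.exp ((a + b) * j) * w) := by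
    rw [← mul_assoc, ← Complex.exp_add]
    congr 2
    push_cast
    ring
  have hne (j : ℤ) : Complex.exp ((a + b) * j) * w ≠ 0 := mul_ne_zero (Complex.exp_ne_zero _) hw
  induction k using Int.induction_on with
  | zero => simp
  | succ i ih =>
    rw [step]
    exact (Gfun_bounds_exp_mul h c₁ c₂ (hne _)).trans ih
  | pred i ih =>
    refine Iff.trans ?_ ih
    rw [← Gfun_bounds_exp_mul h c₁ c₂ (hne (-i - 1)), ← step, sub_add_cancel]

/-- On the annulus `r⁻¹ ≤ |u| ≤ r` with `r² = |e^c|`, the point `-1` is, up to a constant, the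
closest point of `{-e^{cm}}` to `u`. -/
theorem mul_norm_one_add_le_norm_add_exp {c u : ℂ} {r : ℝ} (hr : 1 < r)
    (hrc : Real.exp c.re = r ^ 2) (hu : r⁻¹ ≤ ‖u‖) (hu' : ‖u‖ ≤ r) (m : ℤ) :
    (r - 1) / (r ^ 2 * (1 + r)) * ‖1 + u‖ ≤ ‖u + Complex.exp (c * m)‖ := by
  have hr0 : 0 < r := by linarith
  have hκ : (r - 1) / (r ^ 2 * (1 + r)) * ‖1 + u‖ ≤ (r - 1) / r ^ 2 := by
    have h1 : ‖1 + u‖ ≤ 1 + r := (norm_add_le _ _).trans (by simpa using hu')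
    have h2 : (r - 1) / r ^ 2 = (r - 1) / (r ^ 2 * (1 + r)) * (1 + r) := by
      field_simp
    rw [h2]
    have : 0 ≤ r - 1 := by linarith
    gcongr
  have hnorm : ‖Complex.exp (c * m)‖ = (r ^ 2) ^ m := by
    rw [mul_comm, Complex.exp_int_mul, norm_zpow, Complex.norm_exp, hrc]
  have hr2 : 1 ≤ r ^ 2 := by nlinarith
  rcases lt_trichotomy m 0 with hm | rfl | hm
  · refine hκ.trans ?_
    have h1 : (r ^ 2) ^ m ≤ (r ^ 2)⁻¹ := by
      rw [← zpow_neg_one]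
      exact zpow_le_zpow_right₀ hr2 (by omega)
    have h2 := norm_sub_norm_le u (-Complex.exp (c * m))
    rw [norm_neg, sub_neg_eq_add, hnorm] at h2
    have h3 : (r - 1) / r ^ 2 = r⁻¹ - (r ^ 2)⁻¹ := by
      field_simp
    linarith
  · have h1 : (r - 1) / (r ^ 2 * (1 + r)) ≤ 1 := by
      rw [div_le_one (by positivity)]
      nlinarith
    have h2 := mul_le_mul_of_nonneg_right h1 (norm_nonneg (1 + u))
    simpa [add_comm] using h2
  · refine hκ.trans ?_
    have h1 : r ^ 2 ≤ (r ^ 2) ^ m := by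
      simpa using zpow_le_zpow_right₀ hr2 (show (1 : ℤ) ≤ m by omega)
    have h2 := norm_sub_norm_le (Complex.exp (c * m)) (-u)
    rw [norm_neg, sub_neg_eq_add, hnorm, add_comm] at h2
    have h3 : (r - 1) / r ^ 2 ≤ r - 1 := div_le_self (by linarith) hr2
    nlinarith

theorem exp_log_sq_bounds {σ L : ℝ} (hσ : 0 < σ) (hL : |L| ≤ σ / 2) :
    Real.exp (-σ / 4) ≤ Real.exp (L ^ 2 / (2 * σ) - L / 2) ∧
      Real.exp (L ^ 2 / (2 * σ) - L / 2) ≤ Real.exp (σ / 2) := by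
  obtain ⟨h1, h2⟩ := abs_le.1 hL
  have h3 : 0 ≤ L ^ 2 / (2 * σ) := by positivity
  have h4 : L ^ 2 / (2 * σ) ≤ σ / 8 := by
    rw [div_le_iff₀ (by positivity)]
    nlinarith
  constructor <;> apply Real.exp_le_exp.2 <;> linarith

theorem exists_Gfun_bounds_annulus {a b : ℂ} (h : 0 < (a + b).re) :
    ∃ c₁ c₂ : ℝ, 0 < c₁ ∧ 0 < c₂ ∧ ∀ u : ℂ, u ≠ 0 → |Real.log ‖u‖| ≤ (a + b).re / 2 →
      c₁ * gWeight a b u ≤ ‖Gfun a b u‖ ∧ ‖Gfun a b u‖ ≤ c₂ * gWeight a b u := by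
  obtain ⟨α, β, hα, hβ, hA⟩ := exists_norm_Afun_bounds h
  set σ := (a + b).re with hσ
  have hσ' : a.re + b.re = σ := by simp [hσ]
  set r := Real.exp (σ / 2) with hr
  have hr1 : 1 < r := Real.one_lt_exp_iff.2 (by linarith)
  have hr0 : 0 < r - 1 := by linarith
  set κ := (r - 1) / (r ^ 2 * (1 + r)) with hκ
  have hκ0 : 0 < κ := by positivity
  refine ⟨α * α / r, β * β * Real.exp (σ / 4) / κ, by positivity, by positivity,
    fun u hu hL => ?_⟩
  have hupos : 0 < ‖u‖ := norm_pos_iff.2 hu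
  obtain ⟨hL1, hL2⟩ := abs_le.1 hL
  have hu1 : ‖u‖ ≤ r := by rwa [hr, ← Real.log_le_iff_le_exp hupos]
  have hu2 : r⁻¹ ≤ ‖u‖ := by rwa [hr, ← Real.exp_neg, ← Real.le_log_iff_exp_le hupos]
  have hinv : ‖1 / u‖ ≤ r := by
    rw [one_div, norm_inv]
    exact inv_le_of_inv_le₀ (by positivity) hu2
  obtain ⟨hE1, hE2⟩ := exp_log_sq_bounds h hL
  obtain ⟨hA1, hA2⟩ := hA u hu1
  obtain ⟨hB1, hB2⟩ := hA (1 / u) hinv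
  have hrc : Real.exp (a + b).re = r ^ 2 := by
    rw [hr, ← Real.exp_nat_mul]
    congr 1
    push_cast
    ring
  have hD1 : κ * ‖1 + u‖ ≤ ⨅ m : ℤ, ‖u + Complex.exp ((a + b) * m)‖ :=
    le_ciInf fun m => mul_norm_one_add_le_norm_add_exp hr1 hrc hu2 hu1 m
  have hD2 : (⨅ m : ℤ, ‖u + Complex.exp ((a + b) * m)‖) ≤ ‖1 + u‖ := by
    refine (ciInf_le ⟨0, ?_⟩ 0).trans_eq (by simp [add_comm])
    rintro _ ⟨m, rfl⟩
    exact norm_nonneg _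
  have hD0 : 0 ≤ ⨅ m : ℤ, ‖u + Complex.exp ((a + b) * m)‖ :=
    le_trans (by positivity) hD1
  simp only [gWeight, Gfun, norm_mul, hσ']
  set D := ⨅ m : ℤ, ‖u + Complex.exp ((a + b) * m)‖
  set E := Real.exp ((Real.log ‖u‖) ^ 2 / (2 * σ) - Real.log ‖u‖ / 2)
  constructor
  · calc α * α / r * (E * D) ≤ α * α / r * (r * ‖1 + u‖) := by gcongr
      _ = ‖1 + u‖ * α * α := by
        field_simp
      _ ≤ _ := by gcongr
  · calc ‖1 + u‖ * ‖Afun a b u‖ * ‖Afun a b (1 / u)‖ ≤ ‖1 + u‖ * β * β := by gcongr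
      _ = β * β * Real.exp (σ / 4) / κ * (Real.exp (-σ / 4) * (κ * ‖1 + u‖)) := by
        rw [neg_div, Real.exp_neg]
        field_simp
      _ ≤ _ := by gcongr

/-- the two-sided estimate
`|G(w)| ≍ exp(log²|w|/(2(s+t)) − log|w|/2) · dist(w, W)`, where `W = {−e^{(a+b)m}}_{m∈ℤ}`. -/
theorem statement8 (a b : ℂ) (ha : 0 < a.re) (hb : 0 < b.re) :
    ∃ c₁ c₂ : ℝ, 0 < c₁ ∧ 0 < c₂ ∧ ∀ w : ℂ, w ≠ 0 →
      c₁ * (Real.exp ((Real.log ‖w‖) ^ 2 / (2 * (a.re + b.re)) -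
              Real.log ‖w‖ / 2) *
            (⨅ m : ℤ, ‖w + Complex.exp ((a + b) * m)‖)) ≤
          ‖Gfun a b w‖ ∧
      ‖Gfun a b w‖ ≤
        c₂ * (Real.exp ((Real.log ‖w‖) ^ 2 / (2 * (a.re + b.re)) -
              Real.log ‖w‖ / 2) *
            (⨅ m : ℤ, ‖w + Complex.exp ((a + b) * m)‖)) := by
  have h : 0 < (a + b).re := by simpa using add_pos ha hb
  obtain ⟨c₁, c₂, hc₁, hc₂, hbound⟩ := exists_Gfun_bounds_annulus h
  refine ⟨c₁, c₂, hc₁, hc₂, fun w hw => ?_⟩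
  set k : ℤ := round (Real.log ‖w‖ / (a + b).re) with hk
  set u : ℂ := Complex.exp (-((a + b) * k)) * w with hu
  have hu0 : u ≠ 0 := mul_ne_zero (Complex.exp_ne_zero _) hw
  have hwu : Complex.exp ((a + b) * k) * u = w := by
    rw [hu, ← mul_assoc, ← Complex.exp_add, add_neg_cancel, Complex.exp_zero, one_mul]
  have hlog : Real.log ‖u‖ = (Real.log ‖w‖ / (a + b).re - k) * (a + b).re := by
    have hre : (-((a + b) * (k : ℂ))).re = -((a + b).re * k) := by simp [Complex.mul_re]
    rw [hu, norm_mul, Real.log_mul (by simp) (by simpa using hw), Complex.norm_exp,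
      Real.log_exp, hre]
    field_simp
    ring
  have hL : |Real.log ‖u‖| ≤ (a + b).re / 2 := by
    rw [hlog, abs_mul, abs_of_pos h]
    nlinarith [abs_sub_round (Real.log ‖w‖ / (a + b).re)]
  have hw' := (Gfun_bounds_exp_int_mul h c₁ c₂ hu0 k).2 (hbound u hu0 hL)
  rw [hwu] at hw'
  exact hw'

end
end

section
/- Let a, b ∈ ℂ with Re a > 0 and Re b > 0, and let g(x) = 1/(e^{ax} + e^{-bx}). Then there exist constants C₁, C₂ > 0 such that C₁‖(c_n)‖_{ℓ²(ℤ)} ≤ ‖Σ_{n∈ℤ} c_n g(·−n)‖_{L²(ℝ)} ≤ C₂‖(c_n)‖_{ℓ²(ℤ)} for every (c_n) ∈ ℓ²(ℤ). -/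
open MeasureTheory Filter Metric Complex

noncomputable section

theorem summable_exp_neg_mul_abs_int {η : ℝ} (hη : 0 < η) :
    Summable fun k : ℤ => Real.exp (-η * |(k : ℝ)|) := by
  have h : Summable fun n : ℕ => Real.exp (n * (-η)) :=
    Real.summable_exp_nat_mul_iff.mpr (neg_lt_zero.mpr hη)
  refine Summable.of_nat_of_neg ?_ ?_ <;> simpa [mul_comm] using h

theorem norm_fourier_apply (k : ℤ) (t : UnitAddCircle) : ‖fourier k t‖ = 1 :=
  Circle.norm_coe _

theorem continuous_tsum_mul_fourier {γ : ℤ → ℂ} (hγ : Summable fun k => ‖γ k‖) :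
    Continuous fun t : UnitAddCircle => ∑' k, γ k * fourier k t :=
  continuous_tsum (fun k => continuous_const.mul (map_continuous (fourier k))) hγ
    fun k t => by rw [norm_mul, norm_fourier_apply, mul_one]

/-- Multiplying by an absolutely convergent Fourier series convolves the Fourier coefficients. -/
theorem fourierCoeff_tsum_mul {γ : ℤ → ℂ} (hγ : Summable fun k => ‖γ k‖) {u : UnitAddCircle → ℂ}
    (hu : Integrable u AddCircle.haarAddCircle) (m : ℤ) :
    fourierCoeff (fun t => (∑' k, γ k * fourier k t) * u t) m =
      ∑' n, fourierCoeff u n * γ (m - n) := by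
  have hint : ∀ k : ℤ, Integrable (fun t => γ k * (fourier (-(m - k)) t • u t))
      AddCircle.haarAddCircle := fun k => (hu.fourier_smul _).const_mul _
  have hnorm : ∀ k : ℤ, ∫ t, ‖γ k * (fourier (-(m - k)) t • u t)‖ ∂AddCircle.haarAddCircle
      = ‖γ k‖ * ∫ t, ‖u t‖ ∂AddCircle.haarAddCircle := fun k => by
    simp_rw [norm_mul, norm_smul, norm_fourier_apply, one_mul]
    rw [integral_const_mul]
  have hsum := hasSum_integral_of_summable_integral_norm hint
    (by simp_rw [hnorm]; exact hγ.mul_right _)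
  have hpt : ∀ t, ∑' k, γ k * (fourier (-(m - k)) t • u t)
      = fourier (-m) t • ((∑' k, γ k * fourier k t) * u t) := fun t => by
    rw [smul_eq_mul, ← tsum_mul_right, ← tsum_mul_left]
    refine tsum_congr fun k => ?_
    rw [neg_sub, sub_eq_add_neg, fourier_add, smul_eq_mul]
    ring
  simp_rw [hpt] at hsum
  rw [fourierCoeff, ← hsum.tsum_eq, ← (Equiv.subLeft m).tsum_eq]
  refine tsum_congr fun n => ?_
  simp only [Equiv.subLeft_apply, sub_sub_cancel]
  rw [integral_const_mul, mul_comm, fourierCoeff]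

/-- The element of `L²` of the circle with prescribed square-summable Fourier coefficients. -/
def fourierSynthesis (c : ℤ → ℂ) (hc : Memℓp c 2) :
    Lp ℂ 2 (AddCircle.haarAddCircle : Measure UnitAddCircle) :=
  fourierBasis.repr.symm ⟨c, hc⟩

theorem fourierCoeff_fourierSynthesis (c : ℤ → ℂ) (hc : Memℓp c 2) (n : ℤ) :
    fourierCoeff (fourierSynthesis c hc) n = c n := by
  rw [← fourierBasis_repr, fourierSynthesis, LinearIsometryEquiv.apply_symm_apply]

/-- **Parseval's identity** in terms of extended nonnegative reals. -/
theorem tsum_enorm_sq_fourierCoeff {u : UnitAddCircle → ℂ}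
    (hu : MemLp u 2 AddCircle.haarAddCircle) :
    ∑' m, ‖fourierCoeff u m‖ₑ ^ 2 = ∫⁻ t, ‖u t‖ₑ ^ 2 ∂AddCircle.haarAddCircle := by
  have h := hasSum_sq_fourierCoeff (hu.toLp u)
  rw [fourierCoeff_congr_ae hu.coeFn_toLp,
    integral_congr_ae (hu.coeFn_toLp.mono fun t ht => by
      change ‖hu.toLp u t‖ ^ 2 = ‖u t‖ ^ 2
      rw [ht])] at h
  have hE : ∀ z : ℂ, ‖z‖ₑ ^ 2 = ENNReal.ofReal (‖z‖ ^ 2) := fun z => by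
    rw [ENNReal.ofReal_pow (norm_nonneg z), ofReal_norm]
  simp_rw [hE]
  rw [← ENNReal.ofReal_tsum_of_nonneg (fun _ => by positivity) h.summable, h.tsum_eq,
    ofReal_integral_eq_lintegral_ofReal hu.norm.integrable_sq (ae_of_all _ fun _ => by positivity)]

theorem tsum_enorm_sq_convolution {γ : ℤ → ℂ} (hγ : Summable fun k => ‖γ k‖)
    (c : ℤ → ℂ) (hc : Memℓp c 2) :
    ∑' m, ‖∑' n, c n * γ (m - n)‖ₑ ^ 2 =
      ∫⁻ t, ‖∑' k, γ k * fourier k t‖ₑ ^ 2 * ‖fourierSynthesis c hc t‖ₑ ^ 2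
        ∂AddCircle.haarAddCircle := by
  have hC := Lp.memLp (fourierSynthesis c hc)
  have hcont := continuous_tsum_mul_fourier hγ
  have hprod : MemLp (fun t => (∑' k, γ k * fourier k t) * fourierSynthesis c hc t) 2
      AddCircle.haarAddCircle := by
    refine hC.of_le_mul (c := ∑' k, ‖γ k‖) (hcont.aestronglyMeasurable.mul hC.1)
      (ae_of_all _ fun t => ?_)
    rw [norm_mul]
    refine mul_le_mul_of_nonneg_right ?_ (norm_nonneg _)
    refine tsum_of_norm_bounded hγ.hasSum fun k => ?_
    rw [norm_mul, norm_fourier_apply, mul_one]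
  have h := tsum_enorm_sq_fourierCoeff hprod
  simp_rw [fourierCoeff_tsum_mul hγ (hC.integrable one_le_two), fourierCoeff_fourierSynthesis,
    enorm_mul, mul_pow] at h
  exact h

theorem Memℓp.summable_norm_sq {c : ℤ → ℂ} (hc : Memℓp c 2) : Summable fun n => ‖c n‖ ^ 2 := by
  simpa using (memℓp_gen_iff (p := 2) (by simp)).mp hc

theorem lintegral_enorm_sq_fourierSynthesis (c : ℤ → ℂ) (hc : Memℓp c 2) :
    ∫⁻ t, ‖fourierSynthesis c hc t‖ₑ ^ 2 ∂AddCircle.haarAddCircle =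
      ENNReal.ofReal (∑' n, ‖c n‖ ^ 2) := by
  rw [← tsum_enorm_sq_fourierCoeff (Lp.memLp _),
    ENNReal.ofReal_tsum_of_nonneg (fun _ => by positivity) hc.summable_norm_sq]
  refine tsum_congr fun n => ?_
  rw [fourierCoeff_fourierSynthesis, ENNReal.ofReal_pow (norm_nonneg _), ofReal_norm]

theorem lintegral_eq_lintegral_Ioc_tsum {F : ℝ → ENNReal} (hF : Measurable F) :
    ∫⁻ x, F x = ∫⁻ x in Set.Ioc (0 : ℝ) 1, ∑' m : ℤ, F (x + m) := by
  have hm : ∀ m : ℤ, Measurable fun x : ℝ => F (x + m) := fun m =>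
    hF.comp (measurable_id.add_const _)
  rw [lintegral_tsum fun m => (hm m).aemeasurable,
    ← setLIntegral_univ, ← iUnion_Ioc_intCast ℝ,
    lintegral_iUnion (fun _ => measurableSet_Ioc) (Set.pairwise_disjoint_Ioc_intCast ℝ)]
  refine tsum_congr fun m => ?_
  rw [← (measurePreserving_add_right volume (m : ℝ)).setLIntegral_comp_preimage
    measurableSet_Ioc hF]
  simp

/-- The Zak transform of a function on the line. -/
def zakTransform (g : ℝ → ℂ) (x : ℝ) (t : UnitAddCircle) : ℂ :=
  ∑' k : ℤ, g (x + k) * fourier k t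

theorem exp_neg_mul_abs_add_le {η : ℝ} (hη : 0 < η) {R x : ℝ} (hx : |x| ≤ R) (k : ℤ) :
    Real.exp (-η * |x + k|) ≤ Real.exp (η * R) * Real.exp (-η * |(k : ℝ)|) := by
  rw [← Real.exp_add, Real.exp_le_exp]
  have h : |(k : ℝ)| ≤ |x + k| + |x| := by
    simpa using abs_sub (x + (k : ℝ)) x
  nlinarith

theorem norm_apply_add_int_le {g : ℝ → ℂ} {K η : ℝ} (hη : 0 < η)
    (hgd : ∀ x, ‖g x‖ ≤ K * Real.exp (-η * |x|)) {R x : ℝ} (hx : |x| ≤ R) (k : ℤ) :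
    ‖g (x + k)‖ ≤ K * (Real.exp (η * R) * Real.exp (-η * |(k : ℝ)|)) := by
  have hK : 0 ≤ K := by simpa using (norm_nonneg _).trans (hgd 0)
  exact (hgd _).trans (mul_le_mul_of_nonneg_left (exp_neg_mul_abs_add_le hη hx k) hK)

theorem summable_norm_apply_add_int {g : ℝ → ℂ} {K η : ℝ} (hη : 0 < η)
    (hgd : ∀ x, ‖g x‖ ≤ K * Real.exp (-η * |x|)) (x : ℝ) :
    Summable fun k : ℤ => ‖g (x + k)‖ :=
  (((summable_exp_neg_mul_abs_int hη).mul_left _).mul_left K).of_nonneg_of_le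
    (fun _ => norm_nonneg _) (norm_apply_add_int_le hη hgd le_rfl)

theorem continuous_zakTransform {g : ℝ → ℂ} (hgc : Continuous g) {K η : ℝ} (hη : 0 < η)
    (hgd : ∀ x, ‖g x‖ ≤ K * Real.exp (-η * |x|)) :
    Continuous fun p : ℝ × UnitAddCircle => zakTransform g p.1 p.2 := by
  refine continuous_iff_continuousAt.mpr fun p => ?_
  have hopen : IsOpen {q : ℝ × UnitAddCircle | |q.1| < |p.1| + 1} :=
    isOpen_lt (by fun_prop) continuous_const
  refine ContinuousOn.continuousAt ?_ (hopen.mem_nhds (lt_add_one |p.1|))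
  refine continuousOn_tsum (fun k => Continuous.continuousOn ?_)
    (((summable_exp_neg_mul_abs_int hη).mul_left (Real.exp (η * (|p.1| + 1)))).mul_left K)
    fun k q hq => ?_
  · exact (hgc.comp (by fun_prop)).mul ((map_continuous (fourier k)).comp continuous_snd)
  · rw [norm_mul, norm_fourier_apply, mul_one]
    exact norm_apply_add_int_le hη hgd (le_of_lt hq) k

theorem summable_mul_apply_sub_int {g : ℝ → ℂ} {K η : ℝ} (hη : 0 < η)
    (hgd : ∀ x, ‖g x‖ ≤ K * Real.exp (-η * |x|)) {c : ℤ → ℂ} (hc : Memℓp c 2) (x : ℝ) :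
    Summable fun n : ℤ => c n * g (x - n) := by
  have hg : Summable fun n : ℤ => ‖g (x - n)‖ := by
    simpa [sub_eq_add_neg, Function.comp_def] using
      (Equiv.neg ℤ).summable_iff.mpr (summable_norm_apply_add_int hη hgd x)
  refine Summable.of_norm ((hg.mul_left (∑' n, ‖c n‖ ^ 2 + 1)).of_nonneg_of_le
    (fun _ => norm_nonneg _) fun n => ?_)
  rw [norm_mul]
  refine mul_le_mul_of_nonneg_right ?_ (norm_nonneg _)
  have h := hc.summable_norm_sq.le_tsum n fun _ _ => by positivity
  nlinarith [sq_nonneg (‖c n‖ - 1)]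

theorem measurable_tsum_mul_apply_sub_int {g : ℝ → ℂ} (hgc : Continuous g) {K η : ℝ} (hη : 0 < η)
    (hgd : ∀ x, ‖g x‖ ≤ K * Real.exp (-η * |x|)) {c : ℤ → ℂ} (hc : Memℓp c 2) :
    Measurable fun x : ℝ => ∑' n : ℤ, c n * g (x - n) := by
  refine measurable_of_tendsto_metrizable' (atTop : Filter (Finset ℤ))
    (f := fun s x => ∑ n ∈ s, c n * g (x - n)) (fun s => ?_)
    (tendsto_pi_nhds.mpr fun x => (summable_mul_apply_sub_int hη hgd hc x).hasSum)
  exact (continuous_finsetSum s fun n _ =>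
    continuous_const.mul (hgc.comp (by fun_prop))).measurable

/-- The energy of the Zak transform over a period, as a function of the frequency. -/
def zakEnergy (g : ℝ → ℂ) (t : UnitAddCircle) : ℝ := ∫ x in (0 : ℝ)..1, ‖zakTransform g x t‖ ^ 2

theorem continuous_zakEnergy {g : ℝ → ℂ} (hgc : Continuous g) {K η : ℝ} (hη : 0 < η)
    (hgd : ∀ x, ‖g x‖ ≤ K * Real.exp (-η * |x|)) : Continuous (zakEnergy g) := by
  refine intervalIntegral.continuous_parametric_intervalIntegral_of_continuous'
    (f := fun t x => ‖zakTransform g x t‖ ^ 2) ?_ 0 1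
  exact (((continuous_zakTransform hgc hη hgd).comp continuous_swap).norm).pow 2

/-- The `L²` norm of a combination of integer translates, in terms of the Zak transform. -/
theorem lintegral_enorm_sq_tsum_translates {g : ℝ → ℂ} (hgc : Continuous g) {K η : ℝ} (hη : 0 < η)
    (hgd : ∀ x, ‖g x‖ ≤ K * Real.exp (-η * |x|)) (c : ℤ → ℂ) (hc : Memℓp c 2) :
    ∫⁻ x : ℝ, ‖∑' n : ℤ, c n * g (x - n)‖ₑ ^ 2 =
      ∫⁻ t, ENNReal.ofReal (zakEnergy g t) * ‖fourierSynthesis c hc t‖ₑ ^ 2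
        ∂AddCircle.haarAddCircle := by
  have hZ := continuous_zakTransform hgc hη hgd
  rw [lintegral_eq_lintegral_Ioc_tsum
    ((measurable_tsum_mul_apply_sub_int hgc hη hgd hc).enorm.pow_const 2)]
  have hx : ∀ x : ℝ, ∑' m : ℤ, ‖∑' n : ℤ, c n * g (x + m - n)‖ₑ ^ 2 =
      ∫⁻ t, ‖zakTransform g x t‖ₑ ^ 2 * ‖fourierSynthesis c hc t‖ₑ ^ 2
        ∂AddCircle.haarAddCircle := fun x => by
    simpa [add_sub_assoc, zakTransform] using
      tsum_enorm_sq_convolution (summable_norm_apply_add_int hη hgd x) c hc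
  simp_rw [hx]
  rw [lintegral_lintegral_swap]
  · refine lintegral_congr fun t => ?_
    have ht : Continuous fun x => zakTransform g x t :=
      hZ.comp (continuous_id.prodMk continuous_const)
    have ht2 : Continuous fun x => ‖zakTransform g x t‖ ^ 2 := ht.norm.pow 2
    rw [lintegral_mul_const _ (ht.measurable.enorm.pow_const 2), zakEnergy,
      intervalIntegral.integral_of_le zero_le_one,
      ofReal_integral_eq_lintegral_ofReal
        ht2.integrableOn_Ioc (ae_of_all _ fun _ => by positivity)]
    simp_rw [ENNReal.ofReal_pow (norm_nonneg _), ofReal_norm]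
  · exact ((hZ.measurable.enorm.pow_const 2).mul
      (((Lp.stronglyMeasurable _).measurable.comp measurable_snd).enorm.pow_const 2)).aemeasurable

/-- A continuous exponentially decaying function whose Zak transform does not vanish identically
in the space variable at any frequency has integer translates forming a Riesz sequence. -/
theorem riesz_bounds_of_zakTransform_ne_zero {g : ℝ → ℂ} (hgc : Continuous g) {K η : ℝ}
    (hη : 0 < η) (hgd : ∀ x, ‖g x‖ ≤ K * Real.exp (-η * |x|))
    (hne : ∀ t, ∃ x ∈ Set.Icc (0 : ℝ) 1, zakTransform g x t ≠ 0) :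
    ∃ C₁ C₂ : ℝ, 0 < C₁ ∧ 0 < C₂ ∧ ∀ c : ℤ → ℂ, Memℓp c 2 →
      C₁ * Real.sqrt (∑' n : ℤ, ‖c n‖ ^ 2) ≤
        Real.sqrt (∫ x : ℝ, ‖∑' n : ℤ, c n * g (x - n)‖ ^ 2) ∧
      Real.sqrt (∫ x : ℝ, ‖∑' n : ℤ, c n * g (x - n)‖ ^ 2) ≤
        C₂ * Real.sqrt (∑' n : ℤ, ‖c n‖ ^ 2) := by
  have hE := continuous_zakEnergy hgc hη hgd
  have hpos : ∀ t, 0 < zakEnergy g t := fun t => by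
    obtain ⟨x, hx, hxne⟩ := hne t
    have ht : Continuous fun x => zakTransform g x t :=
      (continuous_zakTransform hgc hη hgd).comp (continuous_id.prodMk continuous_const)
    exact intervalIntegral.integral_pos zero_lt_one (ht.norm.pow 2).continuousOn
      (fun _ _ => by positivity) ⟨x, hx, by positivity⟩
  obtain ⟨tmin, -, hmin⟩ := isCompact_univ.exists_isMinOn Set.univ_nonempty hE.continuousOn
  obtain ⟨tmax, -, hmax⟩ := isCompact_univ.exists_isMaxOn Set.univ_nonempty hE.continuousOn
  refine ⟨Real.sqrt (zakEnergy g tmin), Real.sqrt (zakEnergy g tmax), Real.sqrt_pos.mpr (hpos _),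
    Real.sqrt_pos.mpr (hpos _), fun c hc => ?_⟩
  have hS : 0 ≤ ∑' n, ‖c n‖ ^ 2 := tsum_nonneg fun _ => by positivity
  have hL := lintegral_enorm_sq_tsum_translates hgc hη hgd c hc
  have hsyn := lintegral_enorm_sq_fourierSynthesis c hc
  have hmeas : Measurable fun t => ‖fourierSynthesis c hc t‖ₑ ^ 2 :=
    (Lp.stronglyMeasurable _).measurable.enorm.pow_const 2
  have hlow : ENNReal.ofReal (zakEnergy g tmin * ∑' n, ‖c n‖ ^ 2) ≤
      ∫⁻ x : ℝ, ‖∑' n : ℤ, c n * g (x - n)‖ₑ ^ 2 := by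
    rw [hL, ENNReal.ofReal_mul (hpos _).le, ← hsyn, ← lintegral_const_mul _ hmeas]
    exact lintegral_mono fun t => by
      gcongr
      exact hmin (Set.mem_univ t)
  have hupp : ∫⁻ x : ℝ, ‖∑' n : ℤ, c n * g (x - n)‖ₑ ^ 2 ≤
      ENNReal.ofReal (zakEnergy g tmax * ∑' n, ‖c n‖ ^ 2) := by
    rw [hL, ENNReal.ofReal_mul (hpos _).le, ← hsyn, ← lintegral_const_mul _ hmeas]
    exact lintegral_mono fun t => by
      gcongr
      exact hmax (Set.mem_univ t)
  have hint : ∫ x : ℝ, ‖∑' n : ℤ, c n * g (x - n)‖ ^ 2 =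
      (∫⁻ x : ℝ, ‖∑' n : ℤ, c n * g (x - n)‖ₑ ^ 2).toReal := by
    rw [integral_eq_lintegral_of_nonneg_ae (ae_of_all _ fun _ => by positivity)
      ((measurable_tsum_mul_apply_sub_int hgc hη hgd hc).norm.pow_const 2).aestronglyMeasurable]
    simp_rw [ENNReal.ofReal_pow (norm_nonneg _), ofReal_norm]
  rw [← Real.sqrt_mul (hpos _).le, ← Real.sqrt_mul (hpos _).le, hint]
  refine ⟨Real.sqrt_le_sqrt ?_, Real.sqrt_le_sqrt ?_⟩
  · exact (ENNReal.ofReal_le_iff_le_toReal (hupp.trans_lt ENNReal.ofReal_lt_top).ne).mp hlow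
  · exact ENNReal.toReal_le_of_le_ofReal (mul_nonneg (hpos _).le hS) hupp

theorem one_sub_exp_neg_le_norm_one_add_exp {δ : ℝ} {w : ℂ} (hw : δ ≤ |w.re|) (hδ : 0 < δ) :
    1 - Real.exp (-δ) ≤ ‖1 + exp w‖ ∧ (1 - Real.exp (-δ)) * Real.exp w.re ≤ ‖1 + exp w‖ := by
  have h1 : 1 - Real.exp w.re ≤ ‖1 + exp w‖ := by
    simpa [norm_exp] using norm_sub_norm_le (1 : ℂ) (-exp w)
  have h2 : Real.exp w.re - 1 ≤ ‖1 + exp w‖ := by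
    simpa [norm_exp, add_comm] using norm_sub_norm_le (exp w) (-1 : ℂ)
  have h0 : 0 ≤ 1 - Real.exp (-δ) := by simpa using hδ.le
  have hr := Real.exp_pos w.re
  rcases le_abs.mp hw with h | h
  · have h3 : 1 ≤ Real.exp w.re * Real.exp (-δ) := by
      rw [← Real.exp_add]
      exact Real.one_le_exp (by linarith)
    have h4 : 1 ≤ Real.exp w.re := Real.one_le_exp (by linarith)
    constructor <;> nlinarith
  · have h3 : Real.exp w.re ≤ Real.exp (-δ) := Real.exp_le_exp.mpr (by linarith)
    have h4 : Real.exp w.re ≤ 1 := Real.exp_le_one_iff.mpr (by linarith)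
    constructor <;> nlinarith

theorem one_add_exp_ne_zero_of_re_ne_zero {w : ℂ} (hw : w.re ≠ 0) : 1 + exp w ≠ 0 := by
  have h := (one_sub_exp_neg_le_norm_one_add_exp le_rfl (abs_pos.mpr hw)).1
  have h0 : 0 < 1 - Real.exp (-|w.re|) := by simpa using hw
  exact norm_pos_iff.mp (h0.trans_le h)

theorem norm_exp_div_one_add_exp_le {δ : ℝ} {w : ℂ} (hδ : 0 < δ) (hw : δ ≤ |w.re|) (v : ℂ)
    {M : ℝ} (hM : v.re ≤ M ∨ v.re - w.re ≤ M) :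
    ‖exp v / (1 + exp w)‖ ≤ (1 - Real.exp (-δ))⁻¹ * Real.exp M := by
  obtain ⟨h1, h2⟩ := one_sub_exp_neg_le_norm_one_add_exp hw hδ
  have h0 : 0 < 1 - Real.exp (-δ) := by simpa using hδ
  rw [norm_div, norm_exp, inv_mul_eq_div, div_le_div_iff₀ (h0.trans_le h1) h0]
  rcases hM with hM | hM
  · exact mul_le_mul (Real.exp_le_exp.mpr hM) h1 h0.le (Real.exp_pos _).le
  · calc Real.exp v.re * (1 - Real.exp (-δ))
        ≤ Real.exp (M + w.re) * (1 - Real.exp (-δ)) := by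
          gcongr
          linarith
      _ = Real.exp M * ((1 - Real.exp (-δ)) * Real.exp w.re) := by rw [Real.exp_add]; ring
      _ ≤ Real.exp M * ‖1 + exp w‖ := by gcongr

theorem one_add_exp_mul_ofReal_ne_zero {s : ℂ} (hs : 0 < s.re) (x : ℝ) : 1 + exp (s * x) ≠ 0 := by
  rcases eq_or_ne x 0 with rfl | hx
  · norm_num
  · exact one_add_exp_ne_zero_of_re_ne_zero (by simp [hs.ne', hx])

theorem exp_mul_div_one_add_exp_decay {a b : ℂ} (ha : 0 < a.re) (hb : 0 < b.re) :
    ∃ K : ℝ, ∀ x : ℝ, ‖exp (b * x) / (1 + exp ((a + b) * x))‖ ≤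
      K * Real.exp (-min a.re b.re * |x|) := by
  have hs : 0 < (a + b).re := by simpa using add_pos ha hb
  have hc : Continuous fun x : ℝ => exp (b * x) / (1 + exp ((a + b) * x)) :=
    Continuous.div (by fun_prop) (by fun_prop) (one_add_exp_mul_ofReal_ne_zero hs)
  obtain ⟨M, hM⟩ := (isCompact_Icc (a := (-1 : ℝ)) (b := 1)).exists_bound_of_continuousOn
    hc.continuousOn
  have hM0 : 0 ≤ M := (norm_nonneg _).trans (hM 0 (by simp))
  have hη : 0 < min a.re b.re := lt_min ha hb
  have hD : 0 ≤ (1 - Real.exp (-(a + b).re))⁻¹ :=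
    inv_nonneg.mpr (sub_nonneg.mpr (Real.exp_le_one_iff.mpr (neg_nonpos.mpr hs.le)))
  refine ⟨M * Real.exp (min a.re b.re) + (1 - Real.exp (-(a + b).re))⁻¹, fun x => ?_⟩
  have hE := Real.exp_pos (-min a.re b.re * |x|)
  rw [add_mul (M * _)]
  rcases le_total |x| 1 with hx | hx
  · refine (hM x (abs_le.mp hx)).trans (le_add_of_le_of_nonneg ?_ (by positivity))
    rw [mul_assoc, ← Real.exp_add]
    exact le_mul_of_one_le_right hM0 (Real.one_le_exp (by nlinarith))
  · refine le_add_of_nonneg_of_le (by positivity) (norm_exp_div_one_add_exp_le hs ?_ _ ?_)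
    · rw [re_mul_ofReal, abs_mul, abs_of_pos hs]
      exact le_mul_of_one_le_right hs.le hx
    · simp only [re_mul_ofReal, add_re]
      rcases le_total 0 x with h | h
      · right
        rw [abs_of_nonneg h]
        nlinarith [min_le_left a.re b.re]
      · left
        rw [abs_of_nonpos h]
        nlinarith [min_le_right a.re b.re]

/-- A two-sided series with a simple pole at `iπ / s` coming from its term of index zero only does
not vanish on a real interval. -/
theorem exists_tsum_exp_div_one_add_exp_ne_zero {a b : ℂ} (ha : 0 < a.re) (hb : 0 < b.re)
    {ω : ℤ → ℂ} (hω0 : ω 0 = 1) (hω : ∀ k, ‖ω k‖ = 1) :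
    ∃ x ∈ Set.Icc (0 : ℝ) 1, ∑' k : ℤ, exp (b * ((x + k : ℝ) : ℂ)) /
      (1 + exp ((a + b) * ((x + k : ℝ) : ℂ))) * ω k ≠ 0 := by
  by_contra! hzero
  set s := a + b with hs_def
  have hs : 0 < s.re := by simpa [hs_def] using add_pos ha hb
  have hs0 : s ≠ 0 := fun h => by simp [h] at hs
  set U : Set ℂ := {z | |(s * z).re| < s.re / 2} with hU_def
  have hUopen : IsOpen U := isOpen_lt (by fun_prop) continuous_const
  have hUconv : Convex ℝ U := by
    have : U = (fun z => (s * z).re) ⁻¹' Set.Ioo (-(s.re / 2)) (s.re / 2) := by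
      ext z
      exact abs_lt (a := (s * z).re)
    rw [this]
    have hlin : IsLinearMap ℝ fun z : ℂ => (s * z).re :=
      ⟨fun x y => by rw [mul_add, add_re], fun r x => by simp; ring⟩
    exact (convex_Ioo _ _).is_linear_preimage hlin
  let F : ℤ → ℂ → ℂ := fun k z =>
    if k = 0 then 1 else (1 + exp (s * z)) * (exp (b * k) / (1 + exp (s * (z + k)))) * ω k
  have hre : ∀ z ∈ U, ∀ k : ℤ, k ≠ 0 → s.re / 2 ≤ |(s * (z + k)).re| := fun z hz k hk => by
    have h1 : (s * (z + k)).re = (s * z).re + s.re * k := by simp [mul_add]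
    have h2 : (1 : ℝ) ≤ |(k : ℝ)| := by exact_mod_cast Int.one_le_abs hk
    have h3 : s.re ≤ |s.re * k| := by
      rw [abs_mul, abs_of_pos hs]
      exact le_mul_of_one_le_right hs.le h2
    have h4 := abs_sub_abs_le_abs_add (s.re * k) (s * z).re
    have h5 : |(s * z).re| < s.re / 2 := hz
    rw [h1, add_comm]
    linarith
  have hdiff : ∀ k, DifferentiableOn ℂ (F k) U := fun k => by
    by_cases hk : k = 0
    · simp only [F, hk, if_true]
      exact differentiableOn_const _
    · simp only [F, hk, if_false]
      refine DifferentiableOn.mul_const (DifferentiableOn.mul (by fun_prop)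
        (DifferentiableOn.div (by fun_prop) (by fun_prop) fun z hz => ?_)) _
      refine one_add_exp_ne_zero_of_re_ne_zero (abs_pos.mp ?_)
      exact (half_pos hs).trans_le (hre z hz k hk)
  set D : ℝ := (1 + Real.exp (s.re / 2)) * ((1 - Real.exp (-(s.re / 2)))⁻¹ *
    Real.exp (s.re / 2)) with hD_def
  have hinv : 0 < (1 - Real.exp (-(s.re / 2)))⁻¹ :=
    inv_pos.mpr (by simpa using hs)
  have hD : 0 ≤ D := by positivity
  have hη : 0 < min a.re b.re := lt_min ha hb
  have hbound : ∀ (k : ℤ) (z : ℂ), z ∈ U →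
      ‖F k z‖ ≤ (1 + D) * Real.exp (-min a.re b.re * |(k : ℝ)|) := fun k z hz => by
    have hzU : |(s * z).re| < s.re / 2 := hz
    by_cases hk : k = 0
    · simp [F, hk, hD]
    · simp only [F, hk, if_false]
      rw [norm_mul, norm_mul, hω, mul_one]
      have h1 : ‖1 + exp (s * z)‖ ≤ 1 + Real.exp (s.re / 2) := by
        refine (norm_add_le _ _).trans ?_
        rw [norm_one, norm_exp]
        gcongr
        exact (le_abs_self _).trans hzU.le
      have h2 : ‖exp (b * k) / (1 + exp (s * (z + k)))‖ ≤ (1 - Real.exp (-(s.re / 2)))⁻¹ *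
          Real.exp (s.re / 2 + -min a.re b.re * |(k : ℝ)|) := by
        refine norm_exp_div_one_add_exp_le (half_pos hs) (hre z hz k hk) _ ?_
        have hbk : (b * k).re = b.re * k := by simp
        have hsk : (s * (z + k)).re = (s * z).re + (a.re + b.re) * k := by simp [mul_add, hs_def]
        rw [hbk, hsk]
        have h3 := (abs_lt.mp hzU).1
        rcases le_total 0 (k : ℝ) with h | h
        · right
          rw [abs_of_nonneg h]
          nlinarith [min_le_left a.re b.re]
        · left
          rw [abs_of_nonpos h]
          nlinarith [min_le_right a.re b.re]
      calc ‖1 + exp (s * z)‖ * ‖exp (b * k) / (1 + exp (s * (z + k)))‖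
          ≤ (1 + Real.exp (s.re / 2)) * ((1 - Real.exp (-(s.re / 2)))⁻¹ *
            Real.exp (s.re / 2 + -min a.re b.re * |(k : ℝ)|)) := by gcongr
        _ = D * Real.exp (-min a.re b.re * |(k : ℝ)|) := by rw [Real.exp_add, hD_def]; ring
        _ ≤ _ := by gcongr; linarith
  have hH : DifferentiableOn ℂ (fun z => ∑' k, F k z) U :=
    differentiableOn_tsum_of_summable_norm
      ((summable_exp_neg_mul_abs_int hη).mul_left (1 + D)) hdiff hUopen hbound
  have hreal : ∀ x ∈ Set.Icc (0 : ℝ) 1, ∑' k, F k x = 0 := fun x hx => by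
    have h1 : ∀ k, F k x = (1 + exp (s * x)) * exp (-(b * x)) *
        (exp (b * ((x + k : ℝ) : ℂ)) / (1 + exp (s * ((x + k : ℝ) : ℂ))) * ω k) := fun k => by
      have hb1 : exp (-(b * x)) * exp (b * ((x + k : ℝ) : ℂ)) = exp (b * k) := by
        rw [← Complex.exp_add]
        congr 1
        push_cast
        ring
      by_cases hk : k = 0
      · have := one_add_exp_mul_ofReal_ne_zero hs x
        subst hk
        simp only [F, if_true, hω0, Int.cast_zero, add_zero, mul_one]
        rw [mul_div_assoc', mul_assoc, ← Complex.exp_add, neg_add_cancel, Complex.exp_zero,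
          mul_one, div_self this]
      · simp only [F, hk, if_false]
        rw [← hb1]
        push_cast
        ring
    simp_rw [h1]
    rw [tsum_mul_left, hzero x hx, mul_zero]
  have h0U : (0 : ℂ) ∈ U := by simpa [hU_def] using hs
  have hfreq : ∃ᶠ z in nhdsWithin (0 : ℂ) {0}ᶜ, ∑' k, F k z = 0 := by
    have htend : Tendsto (fun x : ℝ => (x : ℂ)) (nhdsWithin 0 (Set.Ioi 0))
        (nhdsWithin (0 : ℂ) {0}ᶜ) := by
      refine tendsto_nhdsWithin_iff.mpr ⟨?_, ?_⟩
      · exact (continuous_ofReal.tendsto' 0 0 ofReal_zero).mono_left nhdsWithin_le_nhds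
      · filter_upwards [self_mem_nhdsWithin] with x hx
        simpa using (Set.mem_Ioi.mp hx).ne'
    refine htend.frequently (Eventually.frequently ?_)
    filter_upwards [Ioo_mem_nhdsGT (zero_lt_one (α := ℝ))] with x hx
    exact hreal x ⟨hx.1.le, hx.2.le⟩
  have hpole : (Real.pi * I / s : ℂ) ∈ U := by
    have : s * (Real.pi * I / s) = Real.pi * I := by field_simp
    rw [hU_def, Set.mem_ofPred_eq, this]
    simpa using hs
  have hvanish := (hH.analyticOnNhd hUopen).eqOn_zero_of_preconnected_of_frequently_eq_zero
    hUconv.isPreconnected h0U hfreq hpole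
  have hone : ∑' k, F k (Real.pi * I / s) = 1 := by
    rw [tsum_eq_single 0 fun k hk => ?_]
    · simp [F]
    · simp only [F, hk, if_false]
      rw [mul_div_cancel₀ _ hs0, exp_pi_mul_I]
      simp
  exact one_ne_zero (hone.symm.trans hvanish)

/-- the integer translates of a hyperbolic secant type window satisfy the
two-sided `ℓ² → L²` stability inequality. -/
theorem statement18 (a b : ℂ) (ha : 0 < a.re) (hb : 0 < b.re)
    (g : ℝ → ℂ) (hg : ∀ x : ℝ, g x = 1 / (Complex.exp (a * x) + Complex.exp (-b * x))) :
    ∃ C₁ C₂ : ℝ, 0 < C₁ ∧ 0 < C₂ ∧ ∀ c : ℤ → ℂ, Memℓp c 2 →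
      C₁ * Real.sqrt (∑' n : ℤ, ‖c n‖ ^ 2) ≤
        Real.sqrt (∫ x : ℝ, ‖∑' n : ℤ, c n * g (x - n)‖ ^ 2) ∧
      Real.sqrt (∫ x : ℝ, ‖∑' n : ℤ, c n * g (x - n)‖ ^ 2) ≤
        C₂ * Real.sqrt (∑' n : ℤ, ‖c n‖ ^ 2) := by
  have hs : 0 < (a + b).re := by simpa using add_pos ha hb
  have hg' : ∀ x : ℝ, g x = exp (b * x) / (1 + exp ((a + b) * x)) := fun x => by
    have h1 : exp (a * x) + exp (-b * x) = exp (-(b * x)) * (1 + exp ((a + b) * x)) := by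
      rw [mul_add, mul_one, ← Complex.exp_add]
      ring_nf
    rw [hg, h1, Complex.exp_neg, one_div, mul_inv, inv_inv, div_eq_mul_inv]
  have hgc : Continuous g := by
    rw [funext hg']
    exact Continuous.div (by fun_prop) (by fun_prop) (one_add_exp_mul_ofReal_ne_zero hs)
  obtain ⟨K, hK⟩ := exp_mul_div_one_add_exp_decay ha hb
  refine riesz_bounds_of_zakTransform_ne_zero hgc (lt_min ha hb)
    (fun x => by rw [hg']; exact hK x) fun t => ?_
  obtain ⟨x, hx, hne⟩ := exists_tsum_exp_div_one_add_exp_ne_zero ha hb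
    (ω := fun k => fourier k t) fourier_zero fun k => norm_fourier_apply k t
  refine ⟨x, hx, ?_⟩
  simpa only [zakTransform, hg'] using hne

end
end

section
/- Let a, b ∈ ℂ with Re a > 0 and Re b > 0, and let g(x) = 1/(e^{ax} + e^{-bx}). Then for every ξ ∈ ℝ the Fourier transform of g satisfies ĝ(ξ) = ∫_ℝ e^{−2πiξx} g(x) dx = π / ( (a+b) · sin( π(b − 2πiξ)/(a+b) ) ). In particular, ĝ(ξ) = 1/(α₁ e^{uξ} + β₁ e^{−uξ}) with u = 2π²/(a+b) (which has Re u > 0) and nonzero constants α₁ = ((a+b)/(2πi)) e^{iπb/(a+b)}, β₁ = −((a+b)/(2πi)) e^{−iπb/(a+b)}, and this denominator does not vanish for real ξ. -/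
open MeasureTheory Filter Metric Complex

noncomputable section

/-- Quantitative non-vanishing of `1 + exp z` in a sector around the positive real axis. -/
lemma mul_exp_le_norm_one_add_exp {K : ℝ} (hK : 0 < K) {z : ℂ}
    (him : |z.im| ≤ K * z.re) :
    (1 - Real.exp (-(Real.pi / (2 * K)))) * Real.exp z.re ≤ ‖1 + Complex.exp z‖ := by
  rcases le_total z.re (Real.pi / (2 * K)) with h | h
  · have hle : |z.im| ≤ Real.pi / 2 := by
      refine him.trans ((mul_le_mul_of_nonneg_left h hK.le).trans_eq ?_)
      field_simp
    have hcos : 0 ≤ Real.cos z.im :=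
      Real.cos_nonneg_of_neg_pi_div_two_le_of_le (abs_le.mp hle).1 (abs_le.mp hle).2
    have hexp := Real.exp_pos z.re
    have hnorm : Real.exp z.re ≤ ‖1 + Complex.exp z‖ := by
      refine (sq_le_sq₀ hexp.le (norm_nonneg _)).mp ?_
      rw [← Complex.normSq_eq_norm_sq, Complex.normSq_apply]
      simp only [add_re, one_re, exp_re, add_im, one_im, exp_im, zero_add]
      nlinarith [Real.sin_sq_add_cos_sq z.im, mul_nonneg hexp.le hcos]
    refine le_trans ?_ hnorm
    nlinarith [Real.exp_pos (-(Real.pi / (2 * K)))]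
  · have h1 : Real.exp z.re - 1 ≤ ‖1 + Complex.exp z‖ := by
      have := norm_sub_le (1 + Complex.exp z) 1
      simp only [add_sub_cancel_left, norm_exp, norm_one] at this
      linarith
    have h2 : 1 ≤ Real.exp (-(Real.pi / (2 * K))) * Real.exp z.re := by
      rw [← Real.exp_add]
      exact Real.one_le_exp (by linarith)
    linarith

lemma mul_exp_le_norm_exp_add_exp_neg_of_nonneg {K : ℝ} (hK : 0 < K) {a b : ℂ}
    (hab : |a.im| + |b.im| ≤ K * (a.re + b.re)) {x : ℝ}
    (hx : 0 ≤ x) :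
    (1 - Real.exp (-(Real.pi / (2 * K)))) * Real.exp (a.re * x) ≤
      ‖Complex.exp (a * x) + Complex.exp (-b * x)‖ := by
  have hfac : Complex.exp (a * x) + Complex.exp (-b * x) =
      Complex.exp (-b * x) * (1 + Complex.exp ((a + b) * x)) := by
    rw [mul_add, ← Complex.exp_add]
    ring_nf
  have hre : ((a + b) * x).re = (a.re + b.re) * x := by simp
  have him : ((a + b) * x).im = (a.im + b.im) * x := by simp
  have key := mul_exp_le_norm_one_add_exp hK (z := (a + b) * x)
    (by
      rw [hre, him, abs_mul, abs_of_nonneg hx, ← mul_assoc]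
      exact mul_le_mul_of_nonneg_right ((abs_add_le _ _).trans hab) hx)
  rw [hfac, norm_mul, norm_exp]
  calc _ = Real.exp (-b * x).re *
        ((1 - Real.exp (-(Real.pi / (2 * K)))) * Real.exp ((a + b) * x).re) := by
        rw [mul_left_comm, ← Real.exp_add]
        congr 2
        simp
        ring
    _ ≤ _ := mul_le_mul_of_nonneg_left key (Real.exp_pos _).le

lemma one_sub_exp_neg_pi_div_pos {K : ℝ} (hK : 0 < K) :
    0 < 1 - Real.exp (-(Real.pi / (2 * K))) := by
  rw [sub_pos, Real.exp_lt_one_iff]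
  have := Real.pi_pos
  simp only [Left.neg_neg_iff]
  positivity

/-- In the sector `|Im a| + |Im b| ≤ K (Re a + Re b)` the denominator `exp (a x) + exp (-b x)`
dominates both of its terms, uniformly in `x`. -/
lemma mul_max_exp_le_norm_exp_add_exp_neg {K : ℝ} (hK : 0 < K) {a b : ℂ}
    (ha : 0 < a.re) (hb : 0 < b.re) (hab : |a.im| + |b.im| ≤ K * (a.re + b.re)) (x : ℝ) :
    (1 - Real.exp (-(Real.pi / (2 * K)))) * max (Real.exp (a.re * x)) (Real.exp (-b.re * x)) ≤
      ‖Complex.exp (a * x) + Complex.exp (-b * x)‖ := by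
  rcases le_total 0 x with hx | hx
  · rw [max_eq_left (Real.exp_le_exp.mpr (by nlinarith))]
    exact mul_exp_le_norm_exp_add_exp_neg_of_nonneg hK hab hx
  · rw [max_eq_right (Real.exp_le_exp.mpr (by nlinarith))]
    have key := mul_exp_le_norm_exp_add_exp_neg_of_nonneg (a := b) (b := a) hK
      (by linarith) (neg_nonneg.mpr hx)
    rw [add_comm]
    simpa using key

lemma exp_mul_abs_le_max {a b m x : ℝ} (ha : m ≤ a) (hb : m ≤ b) :
    Real.exp (m * |x|) ≤ max (Real.exp (a * x)) (Real.exp (-b * x)) := by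
  rcases le_total 0 x with hx | hx
  · rw [abs_of_nonneg hx]
    exact le_max_of_le_left (Real.exp_le_exp.mpr (by nlinarith))
  · rw [abs_of_nonpos hx]
    exact le_max_of_le_right (Real.exp_le_exp.mpr (by nlinarith))

lemma integrable_exp_neg_mul_abs {m : ℝ} (hm : 0 < m) :
    Integrable (fun x : ℝ => Real.exp (-m * |x|)) := by
  rw [← integrableOn_univ, ← Set.Iic_union_Ioi (a := (0 : ℝ))]
  refine IntegrableOn.union ?_ ?_
  · refine (integrableOn_exp_mul_Iic hm 0).congr_fun (fun x hx => ?_) measurableSet_Iic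
    simp only [abs_of_nonpos (Set.mem_Iic.mp hx)]
    ring_nf
  · refine (exp_neg_integrableOn_Ioi 0 hm).congr_fun (fun x hx => ?_) measurableSet_Ioi
    simp only [abs_of_pos (Set.mem_Ioi.mp hx)]

lemma exp_add_exp_neg_ne_zero {a b : ℂ} (ha : 0 < a.re) (hb : 0 < b.re) (x : ℝ) :
    Complex.exp (a * x) + Complex.exp (-b * x) ≠ 0 := by
  have hK : 0 < (|a.im| + |b.im| + 1) / (a.re + b.re) := by positivity
  have h := mul_max_exp_le_norm_exp_add_exp_neg hK ha hb
    (by rw [div_mul_cancel₀ _ (by positivity)]; linarith) x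
  refine norm_pos_iff.mp (lt_of_lt_of_le ?_ h)
  exact mul_pos (one_sub_exp_neg_pi_div_pos hK) (lt_max_of_lt_left (Real.exp_pos _))

lemma continuous_one_div_exp_add_exp_neg {a b : ℂ} (ha : 0 < a.re) (hb : 0 < b.re) :
    Continuous fun x : ℝ => 1 / (Complex.exp (a * x) + Complex.exp (-b * x)) :=
  continuous_const.div (by fun_prop) (exp_add_exp_neg_ne_zero ha hb)

lemma integrable_one_div_exp_add_exp_neg {a b : ℂ} (ha : 0 < a.re) (hb : 0 < b.re) :
    Integrable fun x : ℝ => 1 / (Complex.exp (a * x) + Complex.exp (-b * x)) := by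
  have hK : 0 < (|a.im| + |b.im| + 1) / (a.re + b.re) := by positivity
  set K := (|a.im| + |b.im| + 1) / (a.re + b.re) with hKdef
  have hδ := one_sub_exp_neg_pi_div_pos hK
  set δ := 1 - Real.exp (-(Real.pi / (2 * K)))
  refine ((integrable_exp_neg_mul_abs (lt_min ha hb)).const_mul δ⁻¹).mono'
    (continuous_one_div_exp_add_exp_neg ha hb).aestronglyMeasurable (ae_of_all _ fun x => ?_)
  have h := mul_max_exp_le_norm_exp_add_exp_neg hK ha hb
    (by rw [hKdef, div_mul_cancel₀ _ (by positivity)]; linarith) x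
  have h' := (mul_le_mul_of_nonneg_left
    (exp_mul_abs_le_max (x := x) (min_le_left a.re b.re) (min_le_right _ _)) hδ.le).trans h
  rw [norm_div, norm_one, neg_mul (min _ _), Real.exp_neg, ← mul_inv, one_div]
  exact inv_anti₀ (mul_pos hδ (Real.exp_pos _)) h'

lemma differentiableOn_integral_one_div_exp_add_exp_neg {b : ℂ} (hb : 0 < b.re) :
    DifferentiableOn ℂ
      (fun a : ℂ => ∫ x : ℝ, 1 / (Complex.exp (a * x) + Complex.exp (-b * x)))
      {a | 0 < a.re} := by
  intro a₀ ha₀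
  rw [Set.mem_ofPred_eq] at ha₀
  set ρ := a₀.re / 2 with hρdef
  have hρ : 0 < ρ := by positivity
  have hre : ∀ a ∈ ball a₀ ρ, ρ ≤ a.re := fun a h => by
    have := (abs_le.mp ((abs_re_le_norm (a - a₀)).trans (mem_ball_iff_norm.mp h).le)).1
    rw [sub_re] at this
    linarith
  have him : ∀ a ∈ ball a₀ ρ, |a.im| ≤ |a₀.im| + ρ := fun a h => by
    have := (abs_im_le_norm (a - a₀)).trans (mem_ball_iff_norm.mp h).le
    rw [sub_im] at this
    linarith [abs_sub_abs_le_abs_sub a.im a₀.im]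
  have hK : 0 < (|a₀.im| + ρ + |b.im|) / ρ := by positivity
  set K := (|a₀.im| + ρ + |b.im|) / ρ with hKdef
  have hsector : ∀ a ∈ ball a₀ ρ, |a.im| + |b.im| ≤ K * (a.re + b.re) := fun a h => by
    calc |a.im| + |b.im| ≤ K * ρ := by
          rw [hKdef, div_mul_cancel₀ _ hρ.ne']
          linarith [him a h]
      _ ≤ _ := mul_le_mul_of_nonneg_left (by linarith [hre a h]) hK.le
  have hδ := one_sub_exp_neg_pi_div_pos hK
  have hlow : ∀ a ∈ ball a₀ ρ, ∀ x : ℝ, _ := fun a h x =>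
    mul_max_exp_le_norm_exp_add_exp_neg hK (hρ.trans_le (hre a h)) hb (hsector a h) x
  set δ := 1 - Real.exp (-(Real.pi / (2 * K)))
  set m := min ρ b.re
  have hm : 0 < m := lt_min hρ hb
  have hderiv := hasDerivAt_integral_of_dominated_loc_of_deriv_le (𝕜 := ℂ) (μ := volume)
    (F := fun (a : ℂ) (x : ℝ) => 1 / (Complex.exp (a * x) + Complex.exp (-b * x)))
    (F' := fun (a : ℂ) (x : ℝ) =>
      -(x * Complex.exp (a * x)) / (Complex.exp (a * x) + Complex.exp (-b * x)) ^ 2)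
    (bound := fun x => (δ⁻¹ ^ 2 * (2 / m)) * Real.exp (-(m / 2) * |x|))
    (ball_mem_nhds a₀ hρ) ?_ (integrable_one_div_exp_add_exp_neg ha₀ hb) ?_ ?_
    ((integrable_exp_neg_mul_abs (half_pos hm)).const_mul _) ?_
  · exact hderiv.2.differentiableAt.differentiableWithinAt
  · filter_upwards [ball_mem_nhds a₀ hρ] with a h
    exact (continuous_one_div_exp_add_exp_neg
      (hρ.trans_le (hre a h)) hb).aestronglyMeasurable
  · refine Continuous.aestronglyMeasurable ?_
    exact Continuous.div (by fun_prop) (by fun_prop)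
      fun x => pow_ne_zero 2 (exp_add_exp_neg_ne_zero ha₀ hb x)
  · refine ae_of_all _ fun x a h => ?_
    have hD := hlow a h x
    set D := ‖Complex.exp (a * x) + Complex.exp (-b * x)‖ with hDdef
    have hmax := exp_mul_abs_le_max (x := x) ((min_le_left ρ b.re).trans (hre a h))
      (min_le_right ρ b.re)
    set M := max (Real.exp (a.re * x)) (Real.exp (-b.re * x)) with hMdef
    have hM : 0 < M := lt_max_of_lt_left (Real.exp_pos _)
    have hxle : |x| ≤ 2 / m * Real.exp (m / 2 * |x|) := by
      have := Real.add_one_le_exp (m / 2 * |x|)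
      rw [div_mul_eq_mul_div, le_div_iff₀ hm]
      linarith
    rw [norm_div, norm_neg, norm_mul, norm_pow, norm_real, Real.norm_eq_abs, norm_exp, ← hDdef]
    have hreax : (a * (x : ℂ)).re = a.re * x := by simp
    rw [hreax]
    calc |x| * Real.exp (a.re * x) / D ^ 2
        ≤ |x| * M / (δ * M) ^ 2 := by
          gcongr
          exact le_max_left _ _
      _ = δ⁻¹ ^ 2 * (|x| / M) := by field_simp
      _ ≤ δ⁻¹ ^ 2 * ((2 / m * Real.exp (m / 2 * |x|)) / Real.exp (m * |x|)) := by gcongr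
      _ = _ := by
          rw [mul_div_assoc, ← Real.exp_sub, ← mul_assoc]
          congr 2
          ring
  · refine ae_of_all _ fun x a h => ?_
    have hne := exp_add_exp_neg_ne_zero (hρ.trans_le (hre a h)) hb x
    have h1 : HasDerivAt (fun a : ℂ => Complex.exp (a * x) + Complex.exp (-b * x))
        (x * Complex.exp (a * x)) a := by
      simpa [mul_comm] using
        (((hasDerivAt_id a).mul_const (x : ℂ)).cexp).add_const (Complex.exp (-b * x))
    simpa only [one_div] using h1.fun_inv hne

lemma integral_one_div_exp_add_exp_neg_comm (a b : ℂ) :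
    ∫ x : ℝ, 1 / (Complex.exp (a * x) + Complex.exp (-b * x)) =
      ∫ x : ℝ, 1 / (Complex.exp (b * x) + Complex.exp (-a * x)) := by
  rw [← integral_neg_eq_self]
  simp [add_comm]

/-- Euler's beta integral `B(w, 1 - w)` in the variable `x = log (t / (1 - t))`. -/
lemma integral_exp_mul_div_one_add_exp {w : ℝ} (h0 : 0 < w) (h1 : w < 1) :
    ∫ y : ℝ, Complex.exp (w * y) / (1 + Complex.exp y) =
      Real.pi / Complex.sin (Real.pi * w) := by
  have hbeta := Complex.Gamma_mul_Gamma_eq_betaIntegral (s := w) (t := 1 - w)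
    (by simpa) (by simpa)
  rw [Complex.Gamma_mul_Gamma_one_sub, add_sub_cancel, Complex.Gamma_one, one_mul] at hbeta
  rw [hbeta, Complex.betaIntegral, intervalIntegral.integral_of_le zero_le_one,
    integral_Ioc_eq_integral_Ioo, ← Real.range_sigmoid, ← Set.image_univ,
    integral_image_eq_integral_abs_deriv_smul MeasurableSet.univ
      (fun x _ => (Real.hasDerivAt_sigmoid x).hasDerivWithinAt) Real.sigmoid_injective.injOn,
    setIntegral_univ]
  refine integral_congr_ae (ae_of_all _ fun y => ?_)
  have hs := Real.sigmoid_pos y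
  have hs1 : 0 < 1 - Real.sigmoid y := sub_pos.mpr (Real.sigmoid_lt_one y)
  have hc1 : (1 - (Real.sigmoid y : ℂ)) = ((1 - Real.sigmoid y : ℝ) : ℂ) := by push_cast; ring
  have hlog : Real.log (Real.sigmoid y) = y + Real.log (1 - Real.sigmoid y) := by
    have hmul : Real.sigmoid y = Real.exp y * (1 - Real.sigmoid y) := by
      rw [← Real.sigmoid_neg, ← Real.sigmoid_mul_rexp_neg, mul_left_comm, ← Real.exp_add]
      simp
    conv_lhs => rw [hmul, Real.log_mul (Real.exp_pos y).ne' hs1.ne', Real.log_exp]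
  have hone : 1 - Real.sigmoid y = (1 + Real.exp y)⁻¹ := by
    rw [← Real.sigmoid_neg, Real.sigmoid_def, neg_neg]
  have hreal : Real.exp (w * y) / (1 + Real.exp y) =
      (Real.sigmoid y * (1 - Real.sigmoid y)) *
        (Real.sigmoid y ^ (w - 1) * (1 - Real.sigmoid y) ^ (1 - w - 1)) := by
    rw [Real.rpow_sub_one hs.ne', Real.rpow_sub_one hs1.ne', div_eq_mul_inv, ← hone,
      Real.rpow_def_of_pos hs, Real.rpow_def_of_pos hs1, hlog]
    field_simp
    rw [← Real.exp_add]
    conv_lhs => rw [← Real.exp_log hs1, ← Real.exp_add]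
    ring_nf
  simp only [Complex.real_smul]
  rw [abs_of_pos (mul_pos hs hs1), hc1]
  have hcast := congrArg (Complex.ofReal) hreal
  push_cast [Complex.ofReal_cpow hs.le, Complex.ofReal_cpow hs1.le] at hcast ⊢
  exact hcast

lemma integral_one_div_exp_add_exp_neg_ofReal {a b : ℝ} (ha : 0 < a) (hb : 0 < b) :
    ∫ x : ℝ, 1 / (Complex.exp (a * x) + Complex.exp (-b * x)) =
      Real.pi / ((a + b) * Complex.sin (Real.pi * b / (a + b))) := by
  have hc : 0 < a + b := add_pos ha hb
  have hcC : (a + b : ℂ) ≠ 0 := by exact_mod_cast hc.ne'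
  have key := integral_exp_mul_div_one_add_exp (w := b / (a + b)) (by positivity)
    ((div_lt_one hc).mpr (by linarith))
  have hsub := Measure.integral_comp_mul_left
    (fun y : ℝ => Complex.exp ((b / (a + b) : ℝ) * y) / (1 + Complex.exp y)) (a + b)
  rw [key, abs_of_pos (inv_pos.mpr hc), Complex.real_smul] at hsub
  have hrhs : (Real.pi : ℂ) / ((a + b) * Complex.sin (Real.pi * b / (a + b))) =
      ((a + b)⁻¹ : ℝ) * (Real.pi / Complex.sin (Real.pi * (b / (a + b) : ℝ))) := by
    push_cast
    rw [mul_div_assoc, div_mul_eq_div_div, div_right_comm]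
    ring
  rw [hrhs, ← hsub]
  refine integral_congr_ae (ae_of_all _ fun x => ?_)
  have h1 : ((b / (a + b) : ℝ) : ℂ) * ((a + b) * x : ℝ) = b * x := by
    push_cast
    field_simp
  have h2 : Complex.exp (((a + b) * x : ℝ) : ℂ) =
      Complex.exp (b * x) * Complex.exp (a * x) := by
    rw [← Complex.exp_add]
    push_cast
    ring_nf
  simp only [h1, h2]
  rw [neg_mul, Complex.exp_neg]
  have := Complex.exp_ne_zero (b * x)
  rw [show Complex.exp (a * x) + (Complex.exp (b * x))⁻¹ =
    (1 + Complex.exp (b * x) * Complex.exp (a * x)) / Complex.exp (b * x) by field_simp; ring,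
    one_div_div]

lemma sin_pi_mul_div_add_ne_zero {a b : ℂ} (ha : 0 < a.re) (hb : 0 < b.re) :
    Complex.sin (Real.pi * b / (a + b)) ≠ 0 := by
  have hab : a + b ≠ 0 := fun h => by
    have := congrArg re h
    simp at this
    linarith
  rw [Complex.sin_ne_zero_iff]
  intro k hk
  have hpi : (Real.pi : ℂ) ≠ 0 := ofReal_ne_zero.mpr Real.pi_ne_zero
  have hb' : b = (k : ℝ) * (a + b) := by
    rw [div_eq_iff hab] at hk
    apply mul_left_cancel₀ hpi
    rw [hk]
    push_cast
    ring
  have hre := congrArg re hb'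
  rw [re_ofReal_mul, add_re] at hre
  have h0 : (0 : ℝ) < k := by
    by_contra! h
    nlinarith
  have h1 : (k : ℝ) < 1 := by
    by_contra! h
    nlinarith
  norm_cast at h0 h1
  lia

lemma differentiableOn_pi_div_add_mul_sin {b : ℂ} (hb : 0 < b.re) :
    DifferentiableOn ℂ
      (fun a : ℂ => Real.pi / ((a + b) * Complex.sin (Real.pi * b / (a + b))))
      {a | 0 < a.re} := by
  intro a ha
  have hab : a + b ≠ 0 := fun h => by
    have := congrArg re h
    simp at this ha
    linarith
  have hsin := sin_pi_mul_div_add_ne_zero ha hb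
  have hquot : DifferentiableAt ℂ (fun a : ℂ => Real.pi * b / (a + b)) a :=
    (differentiableAt_const _).div (by fun_prop) hab
  exact ((differentiableAt_const _).div
    ((by fun_prop : DifferentiableAt ℂ (fun a : ℂ => a + b) a).mul hquot.csin)
    (mul_ne_zero hab hsin)).differentiableWithinAt

/-- Two holomorphic functions on the right half-plane that agree on the positive real axis
coincide. -/
lemma eq_of_eq_on_pos_real {f h : ℂ → ℂ} (hf : DifferentiableOn ℂ f {a | 0 < a.re})
    (hh : DifferentiableOn ℂ h {a | 0 < a.re}) (heq : ∀ t : ℝ, 0 < t → f t = h t) {a : ℂ}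
    (ha : 0 < a.re) : f a = h a := by
  have hopen : IsOpen {a : ℂ | 0 < a.re} := isOpen_lt continuous_const continuous_re
  have hconv : Convex ℝ {a : ℂ | 0 < a.re} := convex_halfSpace_re_gt 0
  refine (hf.analyticOnNhd hopen).eqOn_of_preconnected_of_frequently_eq
    (hh.analyticOnNhd hopen) hconv.isPreconnected (z₀ := 1) (by simp) ?_ ha
  have htend : Tendsto (fun t : ℝ => (t : ℂ)) (nhdsWithin 1 {1}ᶜ) (nhdsWithin 1 {1}ᶜ) := by
    refine tendsto_nhdsWithin_iff.mpr ⟨?_, ?_⟩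
    · exact (Complex.continuous_ofReal.tendsto' 1 1 (by simp)).mono_left nhdsWithin_le_nhds
    · filter_upwards [self_mem_nhdsWithin] with t ht
      simpa using ht
  refine htend.frequently (Eventually.frequently ?_)
  filter_upwards [nhdsWithin_le_nhds (lt_mem_nhds zero_lt_one)] with t ht using heq t ht

theorem integral_one_div_exp_add_exp_neg {a b : ℂ} (ha : 0 < a.re) (hb : 0 < b.re) :
    ∫ x : ℝ, 1 / (Complex.exp (a * x) + Complex.exp (-b * x)) =
      Real.pi / ((a + b) * Complex.sin (Real.pi * b / (a + b))) := by
  have hsymm : ∀ {a b : ℂ}, 0 < a.re → 0 < b.re →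
      Complex.sin (Real.pi * b / (a + b)) = Complex.sin (Real.pi * a / (b + a)) := by
    intro a b ha hb
    have hab : a + b ≠ 0 := fun h => by
      have := congrArg re h
      simp at this
      linarith
    rw [← Complex.sin_pi_sub]
    congr 1
    rw [add_comm b a]
    field_simp
    ring
  refine eq_of_eq_on_pos_real (differentiableOn_integral_one_div_exp_add_exp_neg hb)
    (differentiableOn_pi_div_add_mul_sin hb) (fun t ht => ?_) ha
  have ht' : 0 < (t : ℂ).re := by simpa
  rw [integral_one_div_exp_add_exp_neg_comm, hsymm ht' hb, add_comm (t : ℂ)]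
  exact eq_of_eq_on_pos_real (differentiableOn_integral_one_div_exp_add_exp_neg ht')
    (differentiableOn_pi_div_add_mul_sin ht')
    (fun s hs => integral_one_div_exp_add_exp_neg_ofReal hs ht) hb

/-- the Fourier transform of a hyperbolic secant type window:
`ĝ(ξ) = π/((a+b) sin(π(b−2πiξ)/(a+b)))`, which again has hyperbolic secant type form. -/
theorem statement19 (a b : ℂ) (ha : 0 < a.re) (hb : 0 < b.re)
    (g : ℝ → ℂ) (hg : ∀ x : ℝ, g x = 1 / (Complex.exp (a * x) + Complex.exp (-b * x))) :
    (∀ ξ : ℝ,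
      (∫ x : ℝ, Complex.exp (-2 * Real.pi * Complex.I * ξ * x) * g x) =
        (Real.pi : ℂ) /
          ((a + b) * Complex.sin ((Real.pi : ℂ) * (b - 2 * Real.pi * Complex.I * ξ) / (a + b)))) ∧
    (0 < (2 * (Real.pi : ℂ) ^ 2 / (a + b)).re) ∧
    ((a + b) / (2 * Real.pi * Complex.I) * Complex.exp (Complex.I * Real.pi * b / (a + b)) ≠ 0) ∧
    (-((a + b) / (2 * Real.pi * Complex.I)) * Complex.exp (-(Complex.I * Real.pi * b) / (a + b)) ≠ 0) ∧
    (∀ ξ : ℝ,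
      ((a + b) / (2 * Real.pi * Complex.I) * Complex.exp (Complex.I * Real.pi * b / (a + b)) *
          Complex.exp (2 * (Real.pi : ℂ) ^ 2 / (a + b) * ξ) +
        -((a + b) / (2 * Real.pi * Complex.I)) * Complex.exp (-(Complex.I * Real.pi * b) / (a + b)) *
          Complex.exp (-(2 * (Real.pi : ℂ) ^ 2 / (a + b)) * ξ)) ≠ 0 ∧
      (∫ x : ℝ, Complex.exp (-2 * Real.pi * Complex.I * ξ * x) * g x) =
        1 / ((a + b) / (2 * Real.pi * Complex.I) * Complex.exp (Complex.I * Real.pi * b / (a + b)) *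
              Complex.exp (2 * (Real.pi : ℂ) ^ 2 / (a + b) * ξ) +
            -((a + b) / (2 * Real.pi * Complex.I)) * Complex.exp (-(Complex.I * Real.pi * b) / (a + b)) *
              Complex.exp (-(2 * (Real.pi : ℂ) ^ 2 / (a + b)) * ξ))) := by
  have hab : 0 < (a + b).re := by
    rw [add_re]
    positivity
  have hab0 : a + b ≠ 0 := fun h => by simp [h] at hab
  have hpi : (Real.pi : ℂ) ≠ 0 := ofReal_ne_zero.mpr Real.pi_ne_zero
  have hpre : (a + b) / (2 * Real.pi * Complex.I) ≠ 0 :=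
    div_ne_zero hab0 (by simp [Real.pi_ne_zero])
  have hshift : ∀ ξ : ℝ, 0 < (a + 2 * Real.pi * Complex.I * ξ).re ∧
      0 < (b - 2 * Real.pi * Complex.I * ξ).re := fun ξ => by simp [ha, hb]
  have hsum : ∀ ξ : ℝ, a + 2 * Real.pi * Complex.I * ξ + (b - 2 * Real.pi * Complex.I * ξ) =
      a + b := fun ξ => by ring
  have hsin : ∀ ξ : ℝ,
      Complex.sin (Real.pi * (b - 2 * Real.pi * Complex.I * ξ) / (a + b)) ≠ 0 := fun ξ => by
    simpa only [hsum] using sin_pi_mul_div_add_ne_zero (hshift ξ).1 (hshift ξ).2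
  have hfourier : ∀ ξ : ℝ,
      (∫ x : ℝ, Complex.exp (-2 * Real.pi * Complex.I * ξ * x) * g x) =
        (Real.pi : ℂ) / ((a + b) *
          Complex.sin ((Real.pi : ℂ) * (b - 2 * Real.pi * Complex.I * ξ) / (a + b))) := by
    intro ξ
    have key := integral_one_div_exp_add_exp_neg (hshift ξ).1 (hshift ξ).2
    rw [hsum] at key
    rw [← key]
    refine integral_congr_ae (ae_of_all _ fun x => ?_)
    simp only [hg]
    rw [show (a + 2 * Real.pi * Complex.I * ξ) * x =
        a * x + -(-2 * Real.pi * Complex.I * ξ * x) by ring,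
      show -(b - 2 * Real.pi * Complex.I * ξ) * x =
        -b * x + -(-2 * Real.pi * Complex.I * ξ * x) by ring,
      Complex.exp_add, Complex.exp_add, ← add_mul, Complex.exp_neg, ← div_eq_mul_inv,
      one_div_div, mul_one_div]
  have hdenom : ∀ ξ : ℝ,
      (a + b) / (2 * Real.pi * Complex.I) * Complex.exp (Complex.I * Real.pi * b / (a + b)) *
          Complex.exp (2 * (Real.pi : ℂ) ^ 2 / (a + b) * ξ) +
        -((a + b) / (2 * Real.pi * Complex.I)) * Complex.exp (-(Complex.I * Real.pi * b) / (a + b)) *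
          Complex.exp (-(2 * (Real.pi : ℂ) ^ 2 / (a + b)) * ξ) =
      (a + b) * Complex.sin (Real.pi * (b - 2 * Real.pi * Complex.I * ξ) / (a + b)) /
        Real.pi := by
    intro ξ
    set θ := Real.pi * (b - 2 * Real.pi * Complex.I * ξ) / (a + b) with hθ
    have hpos : Complex.I * Real.pi * b / (a + b) + 2 * (Real.pi : ℂ) ^ 2 / (a + b) * ξ =
        θ * Complex.I := by
      rw [hθ]
      field_simp
      linear_combination (2 * Real.pi * ξ : ℂ) * Complex.I_sq
    have hneg : -(Complex.I * Real.pi * b) / (a + b) + -(2 * (Real.pi : ℂ) ^ 2 / (a + b)) * ξ =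
        -θ * Complex.I := by
      rw [neg_mul θ, ← hpos]
      ring
    rw [mul_assoc _ (Complex.exp _), mul_assoc _ (Complex.exp _), ← Complex.exp_add,
      ← Complex.exp_add, hpos, hneg, Complex.sin]
    field_simp
    linear_combination (Complex.exp (Complex.I * θ) - Complex.exp (-(Complex.I * θ))) *
      Complex.I_sq
  refine ⟨hfourier, ?_, mul_ne_zero hpre (Complex.exp_ne_zero _),
    mul_ne_zero (neg_ne_zero.mpr hpre) (Complex.exp_ne_zero _), fun ξ => ⟨?_, ?_⟩⟩
  · rw [show (2 * (Real.pi : ℂ) ^ 2 / (a + b)) = ((2 * Real.pi ^ 2 : ℝ) : ℂ) * (a + b)⁻¹ by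
      push_cast; rw [div_eq_mul_inv], re_ofReal_mul, Complex.inv_re]
    have := Complex.normSq_pos.mpr hab0
    have := Real.pi_pos
    positivity
  · rw [hdenom]
    exact div_ne_zero (mul_ne_zero hab0 (hsin ξ)) hpi
  · rw [hdenom, hfourier, one_div_div]


end
end
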